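/- Let X and X' be types with total cyclic orders, with base points x₀ ∈ X and x₀' ∈ X', let g ≥ 1, and let A₁, B₁, …, A_g, B_g (on X) and A₁', B₁', …, A_g', B_g' (on X') be order-preserving bijections satisfying the surface relation. Suppose that for all words u, v, t each of which is a subword of w or the inverse of a subword of w, one has (u·x₀ = v·x₀ ↔ u·x₀' = v·x₀') and (sbtw (u·x₀) (v·x₀) (t·x₀) ↔ sbtw (u·x₀') (v·x₀') (t·x₀')). Then the Euler numbers agree: e(A, B) = e(A', B'). (Proposition 2.21 of the paper, 'nbrefini1': finitely many order data determine the Euler class.) -/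

import Mathlib

/-- The relation `x ≺ y` on `X` relative to a base point `x₀`:
`x ≺ y` iff (`x = x₀` and `y ≠ x₀`) or `sbtw x₀ x y`. -/
def Prec {X : Type*} [CircularOrder X] (x₀ x y : X) : Prop :=
  (x = x₀ ∧ y ≠ x₀) ∨ sbtw x₀ x y

/-- The strict order `<ₓ₀` on `ℤ × X`. -/
def LtZX {X : Type*} [CircularOrder X] (x₀ : X) (a b : ℤ × X) : Prop :=
  a.1 < b.1 ∨ (a.1 = b.1 ∧ Prec x₀ a.2 b.2)

/-- An order-preserving bijection (permutation) of a cyclically ordered set. -/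
def OrderPreservingPerm {X : Type*} [CircularOrder X] (f : Equiv.Perm X) : Prop :=
  ∀ a b c : X, sbtw a b c → sbtw (f a) (f b) (f c)

/-- A lift of an order-preserving bijection `f` of `X`: a bijection of `ℤ × X` that
projects to `f` and is increasing for `<ₓ₀`. -/
def IsLiftPerm {X : Type*} [CircularOrder X] (x₀ : X) (f : Equiv.Perm X)
    (F : Equiv.Perm (ℤ × X)) : Prop :=
  (∀ p : ℤ × X, (F p).2 = f p.2) ∧
  ∀ a b : ℤ × X, LtZX x₀ a b → LtZX x₀ (F a) (F b)

/-- The shift `h : (n, x) ↦ (n + 1, x)` of `ℤ × X`, as a permutation. -/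
def shiftPerm (X : Type*) : Equiv.Perm (ℤ × X) :=
  Equiv.prodCongr (Equiv.addRight (1 : ℤ)) (Equiv.refl X)

/-- `e` is the Euler number of the tuple `(A, B)` satisfying the surface relation:
some (equivalently, by well-definedness, any) choice of lifts has commutator product
equal to `hᵉ`. -/
def IsEulerNumber {X : Type*} [CircularOrder X] (x₀ : X) {g : ℕ}
    (A B : Fin g → Equiv.Perm X) (e : ℤ) : Prop :=
  ∃ At Bt : Fin g → Equiv.Perm (ℤ × X),
    (∀ i, IsLiftPerm x₀ (A i) (At i)) ∧ (∀ i, IsLiftPerm x₀ (B i) (Bt i)) ∧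
    (List.ofFn fun i => At i * Bt i * (At i)⁻¹ * (Bt i)⁻¹).prod = shiftPerm X ^ e

/-- The word `w = a₁ b₁ a₁⁻¹ b₁⁻¹ ⋯ a_g b_g a_g⁻¹ b_g⁻¹`, as the list of its 4g letters,
each letter interpreted as the corresponding bijection of `X`. -/
def wordW {X : Type*} {g : ℕ} (A B : Fin g → Equiv.Perm X) : List (Equiv.Perm X) :=
  (List.ofFn fun i => [A i, B i, (A i)⁻¹, (B i)⁻¹]).flatten

/-- The element of `Equiv.Perm X` given by the subword of `w` starting at position `s`
of length `l` (`inv = false`), or by its inverse (`inv = true`). -/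
def subwordElt {X : Type*} {g : ℕ} (A B : Fin g → Equiv.Perm X)
    (s l : ℕ) (inv : Bool) : Equiv.Perm X :=
  if inv then (((wordW A B).drop s).take l).prod⁻¹
  else (((wordW A B).drop s).take l).prod

section Prec

variable {X : Type*} [CircularOrder X] {x₀ : X}

theorem Prec.irrefl (x : X) : ¬ Prec x₀ x x := by
  rintro (⟨h, h'⟩ | h)
  · exact h' h
  · exact sbtw_irrefl_right h

theorem Prec.asymm {x y : X} (hxy : Prec x₀ x y) : ¬ Prec x₀ y x := by
  rcases hxy with ⟨rfl, hy⟩ | h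
  · rintro (⟨rfl, h⟩ | h)
    · exact h rfl
    · exact sbtw_irrefl_left_right h
  · rintro (⟨rfl, _⟩ | h')
    · exact sbtw_irrefl_left_right h
    · exact sbtw_asymm h (sbtw_cyclic_left h')

end Prec

theorem shiftPerm_zpow_apply {X : Type*} (k : ℤ) (p : ℤ × X) :
    (shiftPerm X ^ k) p = (p.1 + k, p.2) := by
  induction k using Int.induction_on generalizing p with
  | zero => simp
  | succ n ih =>
    rw [zpow_add_one, Equiv.Perm.mul_apply, ih]
    ext <;> simp [shiftPerm]
    ring
  | pred n ih =>
    rw [zpow_sub_one, Equiv.Perm.mul_apply, ih]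
    ext <;> simp [shiftPerm, Equiv.Perm.inv_def]
    ring

/-- Composing with a suitable power of the shift moves the image of a point into `{0} × X`. -/
theorem exists_shiftPerm_zpow_mul_apply_fst_eq_zero {X : Type*} (F : Equiv.Perm (ℤ × X))
    (p : ℤ × X) : ∃ k : ℤ, ((shiftPerm X ^ k * F) p).1 = 0 :=
  ⟨-(F p).1, by rw [Equiv.Perm.mul_apply, shiftPerm_zpow_apply, add_neg_cancel]⟩

section Lift

variable {X : Type*} [CircularOrder X] {x₀ : X} {f : Equiv.Perm X} {F : Equiv.Perm (ℤ × X)}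

theorem ltZX_of_fst_lt {a b : ℤ × X} (h : a.1 < b.1) : LtZX x₀ a b := Or.inl h

theorem IsLiftPerm.fst_strictMono (hF : IsLiftPerm x₀ f F) (x : X) :
    StrictMono fun n : ℤ => (F (n, x)).1 := by
  intro m n hmn
  rcases hF.2 (m, x) (n, x) (ltZX_of_fst_lt hmn) with h | ⟨_, h⟩
  · exact h
  · rw [hF.1, hF.1] at h
    exact (Prec.irrefl _ h).elim

theorem IsLiftPerm.fst_add_one (hF : IsLiftPerm x₀ f F) (n : ℤ) (x : X) :
    (F (n + 1, x)).1 = (F (n, x)).1 + 1 := by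
  have hmono := hF.fst_strictMono x
  obtain ⟨⟨m, y⟩, hm⟩ := F.surjective ((F (n, x)).1 + 1, f x)
  obtain rfl : y = x := f.injective (by rw [← hF.1 (m, y), hm])
  have hm₁ : (F (m, y)).1 = (F (n, y)).1 + 1 := by rw [hm]
  have hnm : n < m := hmono.lt_iff_lt.1 (show (F (n, y)).1 < (F (m, y)).1 by lia)
  have h₁ : (F (n + 1, y)).1 ≤ (F (m, y)).1 := hmono.monotone (show n + 1 ≤ m by lia)
  have h₂ : (F (n, y)).1 < (F (n + 1, y)).1 := hmono (lt_add_one n)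
  lia

theorem IsLiftPerm.fst_apply (hF : IsLiftPerm x₀ f F) (n : ℤ) (x : X) :
    (F (n, x)).1 = n + (F (0, x)).1 := by
  induction n using Int.induction_on with
  | zero => simp
  | succ n ih =>
    rw [hF.fst_add_one, ih]
    ring
  | pred n ih =>
    have h := hF.fst_add_one (-(n : ℤ) - 1) x
    rw [sub_add_cancel] at h
    lia

theorem IsLiftPerm.commute_shiftPerm_zpow (hF : IsLiftPerm x₀ f F) (k : ℤ) :
    Commute (shiftPerm X ^ k) F := by
  ext ⟨n, x⟩
  · simp only [Equiv.Perm.mul_apply, shiftPerm_zpow_apply]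
    rw [hF.fst_apply n x, hF.fst_apply (n + k) x]
    ring
  · simp [Equiv.Perm.mul_apply, shiftPerm_zpow_apply, hF.1]

theorem IsLiftPerm.shiftPerm_zpow_mul (hF : IsLiftPerm x₀ f F) (k : ℤ) :
    IsLiftPerm x₀ f (shiftPerm X ^ k * F) := by
  refine ⟨fun p => by simp [Equiv.Perm.mul_apply, shiftPerm_zpow_apply, hF.1], fun a b hab => ?_⟩
  simpa [Equiv.Perm.mul_apply, shiftPerm_zpow_apply, LtZX] using hF.2 a b hab

theorem IsLiftPerm.inv_apply_snd (hF : IsLiftPerm x₀ f F) (p : ℤ × X) :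
    (F⁻¹ p).2 = f⁻¹ p.2 := by
  rw [Equiv.Perm.eq_inv_iff_eq, ← hF.1, Equiv.Perm.inv_def, Equiv.apply_symm_apply]

open Classical in
/-- The first coordinate of a lift that sends `(0, x₀)` into `{0} × X`. -/
theorem IsLiftPerm.fst_apply_eq_ite (hF : IsLiftPerm x₀ f F) (h₀ : (F (0, x₀)).1 = 0)
    (p : ℤ × X) : (F p).1 = p.1 + if Prec x₀ (f p.2) (f x₀) then 1 else 0 := by
  obtain ⟨n, x⟩ := p
  rw [hF.fst_apply]
  congr 1
  by_cases hx : x = x₀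
  · subst hx
    rw [h₀, if_neg (Prec.irrefl _)]
  have h₁ := hF.2 (0, x₀) (0, x) (Or.inr ⟨rfl, Or.inl ⟨rfl, hx⟩⟩)
  have h₂ := hF.2 (0, x) (1, x₀) (ltZX_of_fst_lt zero_lt_one)
  have h₃ : (F (1, x₀)).1 = 1 := by rw [hF.fst_apply, h₀, add_zero]
  simp only [LtZX, hF.1, h₀, h₃] at h₁ h₂
  rcases h₂ with h₂ | ⟨h₂, hlt⟩
  · rcases h₁ with h₁ | ⟨h₁, hgt⟩
    · lia
    · rw [← h₁, if_neg hgt.asymm]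
  · rw [h₂, if_pos hlt]

open Classical in
/-- The first coordinate of the inverse of a lift that sends `(0, x₀)` into `{0} × X`. -/
theorem IsLiftPerm.fst_inv_apply_eq_ite (hF : IsLiftPerm x₀ f F) (h₀ : (F (0, x₀)).1 = 0)
    (p : ℤ × X) : (F⁻¹ p).1 = p.1 - if Prec x₀ p.2 (f x₀) then 1 else 0 := by
  have h := hF.fst_apply_eq_ite h₀ (F⁻¹ p)
  rw [hF.inv_apply_snd, Equiv.Perm.inv_def, Equiv.Perm.inv_def, Equiv.apply_symm_apply,
    Equiv.apply_symm_apply] at h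
  rw [Equiv.Perm.inv_def]
  lia

end Lift

theorem commutator_mul_eq_of_commute {G : Type*} [Group G] {y z a b : G} (hyz : Commute y z)
    (hya : Commute y a) (hyb : Commute y b) (hza : Commute z a) (hzb : Commute z b) :
    (y * a) * (z * b) * (y * a)⁻¹ * (z * b)⁻¹ = a * b * a⁻¹ * b⁻¹ := by
  have h : (y * a) * (z * b) = y * z * (a * b) := by
    rw [mul_assoc, ← mul_assoc a, ← hza.eq, mul_assoc, mul_assoc]
  have h' : (z * b) * (y * a) = y * z * (b * a) := by
    rw [mul_assoc, ← mul_assoc b, ← hyb.eq, mul_assoc, ← mul_assoc z, ← hyz.eq]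
  calc (y * a) * (z * b) * (y * a)⁻¹ * (z * b)⁻¹
      = (y * a) * (z * b) * ((z * b) * (y * a))⁻¹ := by group
    _ = a * b * a⁻¹ * b⁻¹ := by
      have hc : Commute (y * z) (a * b * (b * a)⁻¹) :=
        ((hya.mul_left hza).mul_right (hyb.mul_left hzb)).mul_right
          ((hyb.mul_left hzb).mul_right (hya.mul_left hza)).inv_right
      rw [h, h', mul_inv_rev (y * z), ← mul_assoc, mul_assoc (y * z), hc.eq,
        mul_inv_cancel_right]
      group

/-- The Euler number can be computed with lifts that send `(0, x₀)` into `{0} × X`. -/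
theorem IsEulerNumber.exists_normalized {X : Type*} [CircularOrder X] {x₀ : X} {g : ℕ}
    {A B : Fin g → Equiv.Perm X} {e : ℤ} (he : IsEulerNumber x₀ A B e) :
    ∃ At Bt : Fin g → Equiv.Perm (ℤ × X),
      (∀ i, IsLiftPerm x₀ (A i) (At i)) ∧ (∀ i, IsLiftPerm x₀ (B i) (Bt i)) ∧
      (∀ i, (At i (0, x₀)).1 = 0) ∧ (∀ i, (Bt i (0, x₀)).1 = 0) ∧
      (List.ofFn fun i => At i * Bt i * (At i)⁻¹ * (Bt i)⁻¹).prod = shiftPerm X ^ e := by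
  obtain ⟨At, Bt, hA, hB, h⟩ := he
  choose k hk using fun i => exists_shiftPerm_zpow_mul_apply_fst_eq_zero (At i) (0, x₀)
  choose l hl using fun i => exists_shiftPerm_zpow_mul_apply_fst_eq_zero (Bt i) (0, x₀)
  refine ⟨fun i => shiftPerm X ^ k i * At i, fun i => shiftPerm X ^ l i * Bt i,
    fun i => (hA i).shiftPerm_zpow_mul _, fun i => (hB i).shiftPerm_zpow_mul _, hk, hl, ?_⟩
  rw [← h]
  congr 2
  funext i
  exact commutator_mul_eq_of_commute (Commute.zpow_zpow_self _ _ _)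
    ((hA i).commute_shiftPerm_zpow _) ((hB i).commute_shiftPerm_zpow _)
    ((hA i).commute_shiftPerm_zpow _) ((hB i).commute_shiftPerm_zpow _)

section Word

/-- The value of a formal word at an assignment of its generators; a letter `(s, true)` stands
for the generator `s` and `(s, false)` for its inverse. -/
def wordEval {S G : Type*} [Group G] (C : S → G) (u : List (S × Bool)) : G :=
  (u.map fun x => cond x.2 (C x.1) (C x.1)⁻¹).prod

@[simp]
theorem wordEval_nil {S G : Type*} [Group G] (C : S → G) : wordEval C [] = 1 := rfl

theorem wordEval_cons {S G : Type*} [Group G] (C : S → G) (x : S × Bool) (u : List (S × Bool)) :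
    wordEval C (x :: u) = cond x.2 (C x.1) (C x.1)⁻¹ * wordEval C u := by
  simp [wordEval]

@[simp]
theorem wordEval_singleton_true {S G : Type*} [Group G] (C : S → G) (s : S) :
    wordEval C [(s, true)] = C s := by
  simp [wordEval]

/-- The surface word as a formal word in the generators `aᵢ = inl i`, `bᵢ = inr i`. -/
def surfaceWord (g : ℕ) : List ((Fin g ⊕ Fin g) × Bool) :=
  (List.ofFn fun i =>
    [(Sum.inl i, true), (Sum.inr i, true), (Sum.inl i, false), (Sum.inr i, false)]).flatten

variable {g : ℕ}

theorem mem_surfaceWord (s : Fin g ⊕ Fin g) : (s, true) ∈ surfaceWord g := by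
  rw [surfaceWord, List.mem_flatten]
  rcases s with i | i <;> exact ⟨_, List.mem_ofFn.2 ⟨i, rfl⟩, by simp⟩

theorem wordEval_surfaceWord {G : Type*} [Group G] (A B : Fin g → G) :
    wordEval (Sum.elim A B) (surfaceWord g) =
      (List.ofFn fun i => A i * B i * (A i)⁻¹ * (B i)⁻¹).prod := by
  simp [wordEval, surfaceWord, List.map_flatten, List.prod_flatten, List.map_ofFn,
    Function.comp_def, mul_assoc]

theorem map_surfaceWord {X : Type*} (A B : Fin g → Equiv.Perm X) :
    (surfaceWord g).map (fun x => cond x.2 (Sum.elim A B x.1) (Sum.elim A B x.1)⁻¹) =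
      wordW A B := by
  simp [wordW, surfaceWord, List.map_flatten, List.map_ofFn, Function.comp_def]

theorem subwordElt_false {X : Type*} (A B : Fin g → Equiv.Perm X) (s l : ℕ) :
    subwordElt A B s l false =
      wordEval (Sum.elim A B) (((surfaceWord g).drop s).take l) := by
  simp [subwordElt, wordEval, ← map_surfaceWord, List.map_take, List.map_drop]

theorem List.IsInfix.exists_eq_take_drop {α : Type*} {u w : List α} (h : u <:+: w) :
    ∃ s l, u = (w.drop s).take l := by
  obtain ⟨p, q, rfl⟩ := h
  exact ⟨p.length, u.length, by simp⟩

end Word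

theorem snd_wordEval {S X : Type*} [CircularOrder X] {x₀ : X} {C : S → Equiv.Perm X}
    {L : S → Equiv.Perm (ℤ × X)} (hL : ∀ s, IsLiftPerm x₀ (C s) (L s)) (u : List (S × Bool))
    (p : ℤ × X) : (wordEval L u p).2 = wordEval C u p.2 := by
  induction u with
  | nil => rfl
  | cons x u ih =>
    obtain ⟨s, b⟩ := x
    rw [wordEval_cons, wordEval_cons, Equiv.Perm.mul_apply, Equiv.Perm.mul_apply, ← ih]
    cases b
    · exact (hL s).inv_apply_snd _
    · exact (hL s).1 _

/-- Normalized lifts translate the first coordinate along a word `w` in a way that only depends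
on the relative positions of the images of the base point under subwords of `w`. -/
theorem fst_wordEval_eq {S X X' : Type*} [CircularOrder X] [CircularOrder X'] {x₀ : X} {x₀' : X'}
    {C : S → Equiv.Perm X} {C' : S → Equiv.Perm X'}
    {L : S → Equiv.Perm (ℤ × X)} {L' : S → Equiv.Perm (ℤ × X')}
    (hL : ∀ s, IsLiftPerm x₀ (C s) (L s)) (hL' : ∀ s, IsLiftPerm x₀' (C' s) (L' s))
    (h₀ : ∀ s, (L s (0, x₀)).1 = 0) (h₀' : ∀ s, (L' s (0, x₀')).1 = 0)
    {w : List (S × Bool)} (hw : ∀ s, (s, true) ∈ w)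
    (hprec : ∀ u v, u <:+: w → v <:+: w →
      (Prec x₀ (wordEval C u x₀) (wordEval C v x₀) ↔
        Prec x₀' (wordEval C' u x₀') (wordEval C' v x₀')))
    {u : List (S × Bool)} (hu : u <:+ w) :
    (wordEval L u (0, x₀)).1 = (wordEval L' u (0, x₀')).1 := by
  classical
  induction u with
  | nil => rfl
  | cons x u ih =>
    obtain ⟨s, b⟩ := x
    have hu' : u <:+ w := (List.suffix_cons _ u).trans hu
    have hs : [(s, true)] <:+: w := (List.singleton_infix_iff _ _).2 (hw s)
    rw [wordEval_cons, wordEval_cons, Equiv.Perm.mul_apply, Equiv.Perm.mul_apply]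
    cases b
    · have h := hprec u [(s, true)] hu'.isInfix hs
      simp only [wordEval_singleton_true] at h
      rw [cond_false, cond_false, (hL s).fst_inv_apply_eq_ite (h₀ s),
        (hL' s).fst_inv_apply_eq_ite (h₀' s), ih hu', snd_wordEval hL, snd_wordEval hL']
      exact congrArg _ (if_congr h rfl rfl)
    · have h := hprec ((s, true) :: u) [(s, true)] hu.isInfix hs
      rw [wordEval_singleton_true, wordEval_singleton_true, wordEval_cons, wordEval_cons,
        cond_true, cond_true, Equiv.Perm.mul_apply, Equiv.Perm.mul_apply] at h
      rw [cond_true, cond_true, (hL s).fst_apply_eq_ite (h₀ s),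
        (hL' s).fst_apply_eq_ite (h₀' s), ih hu', snd_wordEval hL, snd_wordEval hL']
      exact congrArg _ (if_congr h rfl rfl)

/-- Proposition 2.21 of the paper (`nbrefini1`): if the orbits of the base points under
the subwords of `w` (and their inverses) are cyclically ordered in the same way in `X`
and in `X'`, then the Euler numbers of `(A, B)` and `(A', B')` agree. -/
theorem euler_number_determined_by_finite_order_data
    {X X' : Type*} [CircularOrder X] [CircularOrder X'] (x₀ : X) (x₀' : X')
    (g : ℕ) (hg : 1 ≤ g)
    (A B : Fin g → Equiv.Perm X) (A' B' : Fin g → Equiv.Perm X')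
    (hA : ∀ i, OrderPreservingPerm (A i)) (hB : ∀ i, OrderPreservingPerm (B i))
    (hA' : ∀ i, OrderPreservingPerm (A' i)) (hB' : ∀ i, OrderPreservingPerm (B' i))
    (hrel : (List.ofFn fun i => A i * B i * (A i)⁻¹ * (B i)⁻¹).prod = 1)
    (hrel' : (List.ofFn fun i => A' i * B' i * (A' i)⁻¹ * (B' i)⁻¹).prod = 1)
    (horder : ∀ (s₁ l₁ : ℕ) (i₁ : Bool) (s₂ l₂ : ℕ) (i₂ : Bool) (s₃ l₃ : ℕ) (i₃ : Bool),
      (subwordElt A B s₁ l₁ i₁ x₀ = subwordElt A B s₂ l₂ i₂ x₀ ↔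
        subwordElt A' B' s₁ l₁ i₁ x₀' = subwordElt A' B' s₂ l₂ i₂ x₀') ∧
      (sbtw (subwordElt A B s₁ l₁ i₁ x₀) (subwordElt A B s₂ l₂ i₂ x₀)
          (subwordElt A B s₃ l₃ i₃ x₀) ↔
        sbtw (subwordElt A' B' s₁ l₁ i₁ x₀') (subwordElt A' B' s₂ l₂ i₂ x₀')
          (subwordElt A' B' s₃ l₃ i₃ x₀')))
    (e e' : ℤ) (he : IsEulerNumber x₀ A B e) (he' : IsEulerNumber x₀' A' B' e') :
    e = e' := by
  obtain ⟨At, Bt, hAt, hBt, hAt₀, hBt₀, h⟩ := he.exists_normalized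
  obtain ⟨At', Bt', hAt', hBt', hAt₀', hBt₀', h'⟩ := he'.exists_normalized
  have hprec : ∀ u v, u <:+: surfaceWord g → v <:+: surfaceWord g →
      (Prec x₀ (wordEval (Sum.elim A B) u x₀) (wordEval (Sum.elim A B) v x₀) ↔
        Prec x₀' (wordEval (Sum.elim A' B') u x₀') (wordEval (Sum.elim A' B') v x₀')) := by
    intro u v hu hv
    obtain ⟨s₁, l₁, rfl⟩ := hu.exists_eq_take_drop
    obtain ⟨s₂, l₂, rfl⟩ := hv.exists_eq_take_drop
    have h₁ := (horder s₁ l₁ false 0 0 false 0 0 false).1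
    have h₂ := (horder s₂ l₂ false 0 0 false 0 0 false).1
    have h₃ := (horder 0 0 false s₁ l₁ false s₂ l₂ false).2
    simp only [subwordElt_false, List.take_zero, wordEval_nil, Equiv.Perm.one_apply] at h₁ h₂ h₃
    rw [Prec, Prec, h₁, Ne, Ne, h₂, h₃]
  have key := fst_wordEval_eq (C := Sum.elim A B) (C' := Sum.elim A' B')
    (L := Sum.elim At Bt) (L' := Sum.elim At' Bt')
    (Sum.rec hAt hBt) (Sum.rec hAt' hBt') (Sum.rec hAt₀ hBt₀) (Sum.rec hAt₀' hBt₀')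
    mem_surfaceWord hprec (List.suffix_refl _)
  simpa [wordEval_surfaceWord, h, h', shiftPerm_zpow_apply] using key
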